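/- Let Γ be a geometric distance-regular graph with classical parameters (D, b, α, β) such that b ≥ 2, 1 ≤ α ≤ b−1 and D ≥ 3, with line set 𝓒, and let r = [D]. Assume Γ satisfies the dual Pasch axiom. Then: (1) if a line ℓ ∈ 𝓒 intersects an assembly M, they intersect in exactly α + 1 vertices; (2) if a vertex u ∉ M has a neighbour in an assembly M, then u has exactly α + 1 neighbours in M and there is exactly one line through u that intersects M. Consequently, for every vertex x of Γ, the local graph Δ_x (the subgraph induced on the neighbours of x) is the α-clique extension of the (β/α) × r grid. -/

import Mathlib

open SimpleGraph

namespace DRGPaper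

variable {V : Type*}

/-- `Γ` is a distance-regular graph with diameter `D` and intersection arrays `cc`, `aa`, `bb`:
`Γ` is connected of diameter `D` and for any vertices `x, y` at distance `i ≤ D`, `y` has exactly
`cc i` neighbours at distance `i - 1` from `x`, `aa i` neighbours at distance `i` from `x`,
and `bb i` neighbours at distance `i + 1` from `x`. -/
def IsDRG [Fintype V] (G : SimpleGraph V) (D : ℕ) (cc aa bb : ℕ → ℕ) : Prop :=
  G.Connected ∧
  (∀ x y : V, G.dist x y ≤ D) ∧
  (∃ x y : V, G.dist x y = D) ∧
  ∀ i : ℕ, i ≤ D → ∀ x y : V, G.dist x y = i →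
    {z : V | G.Adj y z ∧ G.dist x z = i - 1}.ncard = cc i ∧
    {z : V | G.Adj y z ∧ G.dist x z = i}.ncard = aa i ∧
    {z : V | G.Adj y z ∧ G.dist x z = i + 1}.ncard = bb i

/-- `[j] = (b^j - 1)/(b - 1) = 1 + b + ⋯ + b^(j-1)` as a real number. -/
def gauss (b j : ℕ) : ℝ := ∑ i ∈ Finset.range j, (b : ℝ) ^ i

/-- `Γ` has classical parameters `(D, b, α, β)`: it is distance-regular of diameter `D` with
`bb i = ([D] - [i])(β - α[i])` for `0 ≤ i ≤ D - 1` and `cc i = [i](1 + α[i-1])` for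
`1 ≤ i ≤ D`. -/
def HasClassicalParams [Fintype V] (G : SimpleGraph V) (D b : ℕ) (α β : ℝ)
    (cc aa bb : ℕ → ℕ) : Prop :=
  IsDRG G D cc aa bb ∧
  (∀ i : ℕ, i ≤ D - 1 → (bb i : ℝ) = (gauss b D - gauss b i) * (β - α * gauss b i)) ∧
  (∀ i : ℕ, 1 ≤ i → i ≤ D → (cc i : ℝ) = gauss b i * (1 + α * gauss b (i - 1)))

/-- `d(x, C) = min {d(x, y) : y ∈ C}`. -/
noncomputable def distToSet (G : SimpleGraph V) (x : V) (C : Set V) : ℕ :=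
  sInf (G.dist x '' C)

/-- A maximal clique of `G`. -/
def IsMaxClique (G : SimpleGraph V) (s : Set V) : Prop :=
  G.IsClique s ∧ ∀ t : Set V, G.IsClique t → s ⊆ t → t = s

/-- The lines for the PLS(γ) property: maximal cliques with at least `γ` vertices. -/
def plsLines (G : SimpleGraph V) (γ : ℕ) : Set (Set V) :=
  {ℓ : Set V | IsMaxClique G ℓ ∧ γ ≤ ℓ.ncard}

/-- `G` is the point graph of the partial linear space with line set `L`: any two adjacent
vertices lie on exactly one common line of `L`. -/
def IsPointGraphOf (G : SimpleGraph V) (L : Set (Set V)) : Prop :=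
  ∀ x y : V, G.Adj x y → ∃! ℓ : Set V, ℓ ∈ L ∧ x ∈ ℓ ∧ y ∈ ℓ

/-- A vertex is a Delsarte vertex (w.r.t. the line set `L` and classical parameter `β`) if all
lines through it have exactly `β + 1` vertices. -/
def IsDelsarteVertex (L : Set (Set V)) (β : ℝ) (x : V) : Prop :=
  ∀ ℓ ∈ L, x ∈ ℓ → (ℓ.ncard : ℝ) = β + 1

/-- The lines for the SPLS(c, s) property: maximal cliques with at least
`a1 + 2 - (c - 1)(s - 1)` vertices. -/
def splsLines (G : SimpleGraph V) (a1 c s : ℕ) : Set (Set V) :=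
  {ℓ : Set V | IsMaxClique G ℓ ∧ (a1 : ℤ) + 2 - ((c : ℤ) - 1) * ((s : ℤ) - 1) ≤ (ℓ.ncard : ℤ)}

/-- The SPLS(c, s) property: `G` is the point graph of the partial linear space whose lines are
the maximal cliques with at least `a1 + 2 - (c-1)(s-1)` vertices, `a1 ≥ (2s-1)(c-1)`, each
vertex lies on at most `s` lines, and every point not on a line `ℓ` is collinear with at most
`c` points of `ℓ`.  SPLS(s) is the case `c = c₂`. -/
def HasSPLS (G : SimpleGraph V) (a1 c s : ℕ) : Prop :=
  1 ≤ c ∧ 2 ≤ s ∧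
  (2 * (s : ℤ) - 1) * ((c : ℤ) - 1) ≤ (a1 : ℤ) ∧
  IsPointGraphOf G (splsLines G a1 c s) ∧
  (∀ x : V, {ℓ ∈ splsLines G a1 c s | x ∈ ℓ}.ncard ≤ s) ∧
  (∀ ℓ ∈ splsLines G a1 c s, ∀ x : V, x ∉ ℓ → {y ∈ ℓ | G.Adj x y}.ncard ≤ c)

/-- `[x, y]`: the set of lines `ℓ ∈ L` through `x` such that `d(y, u) ≤ 2` for all `u ∈ ℓ`. -/
def lineXY (G : SimpleGraph V) (L : Set (Set V)) (x y : V) : Set (Set V) :=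
  {ℓ ∈ L | x ∈ ℓ ∧ ∀ u ∈ ℓ, G.dist y u ≤ 2}

/-- `𝓒` witnesses that `G` is geometric with cliques of order `q`: every member of `𝓒` is a
clique with exactly `q` vertices and every edge of `G` lies in a unique member of `𝓒`. -/
def IsGeomLineSet (G : SimpleGraph V) (q : ℝ) (𝓒 : Set (Set V)) : Prop :=
  (∀ C ∈ 𝓒, G.IsClique C ∧ (C.ncard : ℝ) = q) ∧
  ∀ x y : V, G.Adj x y → ∃! C : Set V, C ∈ 𝓒 ∧ x ∈ C ∧ y ∈ C

/-- `G` is geometric: there is a set of Delsarte cliques (cliques of the maximum order `q`)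
such that every edge lies in a unique member. -/
def IsGeometric (G : SimpleGraph V) (q : ℝ) : Prop :=
  ∃ 𝓒 : Set (Set V), IsGeomLineSet G q 𝓒

/-- An assembly: a maximal clique which is not a line. -/
def IsAssembly (G : SimpleGraph V) (𝓒 : Set (Set V)) (M : Set V) : Prop :=
  IsMaxClique G M ∧ M ∉ 𝓒

/-- The dual Pasch axiom: for every pair of adjacent vertices `x, y`, the common neighbours of
`x` and `y` outside the (any) line of `𝓒` through `x` and `y` form a clique. -/
def DualPasch (G : SimpleGraph V) (𝓒 : Set (Set V)) : Prop :=
  ∀ x y : V, G.Adj x y → ∀ ℓ ∈ 𝓒, x ∈ ℓ → y ∈ ℓ →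
    G.IsClique {z : V | G.Adj x z ∧ G.Adj y z ∧ z ∉ ℓ}

/-- The `m × n` grid, i.e. the Cartesian product `K_m □ K_n`. -/
def gridGraph (m n : ℕ) : SimpleGraph (Fin m × Fin n) :=
  (⊤ : SimpleGraph (Fin m)).boxProd (⊤ : SimpleGraph (Fin n))

/-- The `A`-clique extension of a graph `H`: replace every vertex of `H` by a clique of size
`A`, vertices in distinct cliques being adjacent exactly when the underlying vertices of `H`
are adjacent. -/
def cliqueExt {W : Type*} (H : SimpleGraph W) (A : ℕ) : SimpleGraph (W × Fin A) :=
  SimpleGraph.fromRel (fun p q => H.Adj p.1 q.1 ∨ p.1 = q.1)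

/-- `θ` is an eigenvalue of the adjacency matrix of `G`. -/
def IsAdjEigenvalue [Fintype V] (G : SimpleGraph V) [DecidableRel G.Adj] (θ : ℝ) : Prop :=
  ∃ v : V → ℝ, v ≠ 0 ∧ (G.adjMatrix ℝ).mulVec v = θ • v

theorem IsGeomLineSet.line_eq {G : SimpleGraph V} {q : ℝ} {𝓒 : Set (Set V)}
    (hgeo : IsGeomLineSet G q 𝓒) {ℓ ℓ' : Set V} (hℓ : ℓ ∈ 𝓒) (hℓ' : ℓ' ∈ 𝓒) {x y : V}
    (hne : x ≠ y) (hx : x ∈ ℓ) (hy : y ∈ ℓ) (hx' : x ∈ ℓ') (hy' : y ∈ ℓ') : ℓ = ℓ' :=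
  (hgeo.2 x y ((hgeo.1 ℓ hℓ).1 hx hy hne)).unique ⟨hℓ, hx, hy⟩ ⟨hℓ', hx', hy'⟩

theorem IsMaxClique.mem_of_forall_adj {G : SimpleGraph V} {M : Set V} (hM : IsMaxClique G M)
    {w : V} (hw : ∀ m ∈ M, w ≠ m → G.Adj w m) : w ∈ M := by
  have hclique : G.IsClique (insert w M) := by
    rw [isClique_insert]
    exact ⟨hM.1, hw⟩
  rw [← hM.2 _ hclique (Set.subset_insert w M)]
  exact Set.mem_insert w M

theorem IsAssembly.exists_notMem_line {G : SimpleGraph V} {q : ℝ} {𝓒 : Set (Set V)}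
    (hgeo : IsGeomLineSet G q 𝓒) {M ℓ : Set V} (hM : IsAssembly G 𝓒 M) (hℓ : ℓ ∈ 𝓒) :
    ∃ z ∈ M, z ∉ ℓ := by
  by_contra! hsub
  exact hM.2 (hM.1.2 ℓ (hgeo.1 ℓ hℓ).1 hsub ▸ hℓ)

/-- An assembly through `x` and `y` contains all common neighbours of `x` and `y` off the line
`xy`. -/
theorem IsAssembly.mem_of_adj_of_adj {G : SimpleGraph V} {q : ℝ} {𝓒 : Set (Set V)}
    (hgeo : IsGeomLineSet G q 𝓒) (hpasch : DualPasch G 𝓒) {M ℓ : Set V}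
    (hM : IsAssembly G 𝓒 M) (hℓ : ℓ ∈ 𝓒) {x y w : V} (hne : x ≠ y) (hx : x ∈ M) (hy : y ∈ M)
    (hxℓ : x ∈ ℓ) (hyℓ : y ∈ ℓ) (hxw : G.Adj x w) (hyw : G.Adj y w) (hwℓ : w ∉ ℓ) : w ∈ M := by
  have hxy : G.Adj x y := hM.1.1 hx hy hne
  have hoff : ∀ m ∈ M, m ∉ ℓ → w ≠ m → G.Adj w m := fun m hm hmℓ hwm =>
    hpasch x y hxy ℓ hℓ hxℓ hyℓ ⟨hxw, hyw, hwℓ⟩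
      ⟨hM.1.1 hx hm (by rintro rfl; exact hmℓ hxℓ), hM.1.1 hy hm (by rintro rfl; exact hmℓ hyℓ),
        hmℓ⟩ hwm
  refine hM.1.mem_of_forall_adj fun m hm hwm => ?_
  by_cases hmℓ : m ∈ ℓ
  swap
  · exact hoff m hm hmℓ hwm
  obtain ⟨z, hz, hzℓ⟩ := hM.exists_notMem_line hgeo hℓ
  by_cases hwz : w = z
  · exact hwz ▸ hM.1.1 hz hm (by rintro rfl; exact hzℓ hmℓ)
  have hwzadj : G.Adj w z := hoff z hz hzℓ hwz
  have hmz : G.Adj z m := hM.1.1 hz hm (by rintro rfl; exact hzℓ hmℓ)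
  have hxz : x ≠ z := by rintro rfl; exact hzℓ hxℓ
  have hyz : y ≠ z := by rintro rfl; exact hzℓ hyℓ
  by_cases hmx : m = x
  · exact hmx ▸ hxw.symm
  by_cases hmy : m = y
  · exact hmy ▸ hyw.symm
  obtain ⟨ℓ₁, ⟨hℓ₁, hxℓ₁, hzℓ₁⟩, -⟩ := hgeo.2 x z (hM.1.1 hx hz hxz)
  obtain ⟨ℓ₂, ⟨hℓ₂, hyℓ₂, hzℓ₂⟩, -⟩ := hgeo.2 y z (hM.1.1 hy hz hyz)
  have hm₁ : m ∉ ℓ₁ := fun hm₁ =>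
    hzℓ (hgeo.line_eq hℓ₁ hℓ hmx hm₁ hxℓ₁ hmℓ hxℓ ▸ hzℓ₁)
  have hm₂ : m ∉ ℓ₂ := fun hm₂ =>
    hzℓ (hgeo.line_eq hℓ₂ hℓ hmy hm₂ hyℓ₂ hmℓ hyℓ ▸ hzℓ₂)
  by_cases hw₁ : w ∈ ℓ₁
  · have hw₂ : w ∉ ℓ₂ := by
      intro hw₂
      obtain rfl := hgeo.line_eq hℓ₁ hℓ₂ hwz hw₁ hzℓ₁ hw₂ hzℓ₂
      exact hwℓ (hgeo.line_eq hℓ₁ hℓ hne hxℓ₁ hyℓ₂ hxℓ hyℓ ▸ hw₁)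
    exact hpasch y z (hM.1.1 hy hz hyz) ℓ₂ hℓ₂ hyℓ₂ hzℓ₂ ⟨hyw, hwzadj.symm, hw₂⟩
      ⟨hM.1.1 hy hm (Ne.symm hmy), hmz, hm₂⟩ hwm
  · exact hpasch x z (hM.1.1 hx hz hxz) ℓ₁ hℓ₁ hxℓ₁ hzℓ₁ ⟨hxw, hwzadj.symm, hw₁⟩
      ⟨hM.1.1 hx hm (Ne.symm hmx), hmz, hm₁⟩ hwm

/-- For an assembly `M`, a line `ℓ` meeting `M` and `z ∈ M \ ℓ`, the points of `ℓ` collinear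
with `z` are those of `ℓ ∩ M`. -/
theorem IsAssembly.exists_line_inter_eq {G : SimpleGraph V} {q : ℝ} {𝓒 : Set (Set V)}
    (hgeo : IsGeomLineSet G q 𝓒) (hpasch : DualPasch G 𝓒) {M ℓ : Set V}
    (hM : IsAssembly G 𝓒 M) (hℓ : ℓ ∈ 𝓒) (hne : (ℓ ∩ M).Nonempty) :
    ∃ z ∉ ℓ, (∃ v ∈ ℓ, G.Adj z v) ∧ ℓ ∩ M = {v ∈ ℓ | G.Adj z v} := by
  obtain ⟨x, hxℓ, hx⟩ := hne
  obtain ⟨z, hz, hzℓ⟩ := hM.exists_notMem_line hgeo hℓ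
  have hzv : ∀ v ∈ ℓ, z ≠ v := by rintro v hv rfl; exact hzℓ hv
  have hzx : G.Adj z x := hM.1.1 hz hx (hzv x hxℓ)
  refine ⟨z, hzℓ, ⟨x, hxℓ, hzx⟩, Set.ext fun y => ⟨?_, ?_⟩⟩
  · rintro ⟨hyℓ, hy⟩
    exact ⟨hyℓ, hM.1.1 hz hy (hzv y hyℓ)⟩
  · rintro ⟨hyℓ, hzy⟩
    refine ⟨hyℓ, ?_⟩
    by_cases hyx : y = x
    · exact hyx ▸ hx
    obtain ⟨ℓ₁, ⟨hℓ₁, hzℓ₁, hxℓ₁⟩, -⟩ := hgeo.2 z x hzx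
    refine hM.mem_of_adj_of_adj hgeo hpasch hℓ₁ hzx.ne hz hx hzℓ₁ hxℓ₁ hzy
      ((hgeo.1 ℓ hℓ).1 hxℓ hyℓ (Ne.symm hyx)) fun hyℓ₁ => hzℓ ?_
    exact hgeo.line_eq hℓ₁ hℓ hyx hyℓ₁ hxℓ₁ hyℓ hxℓ ▸ hzℓ₁

/-- The neighbours in an assembly `M` of a vertex `u ∉ M` all lie on one line through `u`. -/
theorem IsAssembly.adj_eq_line_inter {G : SimpleGraph V} {q : ℝ} {𝓒 : Set (Set V)}
    (hgeo : IsGeomLineSet G q 𝓒) (hpasch : DualPasch G 𝓒) {M ℓ : Set V}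
    (hM : IsAssembly G 𝓒 M) (hℓ : ℓ ∈ 𝓒) {u : V} (huM : u ∉ M) (hu : u ∈ ℓ)
    (hne : (ℓ ∩ M).Nonempty) : {v ∈ M | G.Adj u v} = ℓ ∩ M := by
  obtain ⟨v, hvℓ, hv⟩ := hne
  have huw : ∀ w ∈ M, u ≠ w := by rintro w hw rfl; exact huM hw
  ext w
  constructor
  · rintro ⟨hw, hadj⟩
    refine ⟨?_, hw⟩
    by_contra hwℓ
    have hvw : v ≠ w := by rintro rfl; exact hwℓ hvℓ
    obtain ⟨ℓ₁, ⟨hℓ₁, hvℓ₁, hwℓ₁⟩, -⟩ := hgeo.2 v w (hM.1.1 hv hw hvw)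
    refine huM (hM.mem_of_adj_of_adj hgeo hpasch hℓ₁ hvw hv hw hvℓ₁ hwℓ₁
      ((hgeo.1 ℓ hℓ).1 hvℓ hu (huw v hv).symm) hadj.symm fun huℓ₁ => hwℓ ?_)
    exact hgeo.line_eq hℓ₁ hℓ (huw v hv) huℓ₁ hvℓ₁ hu hvℓ ▸ hwℓ₁
  · rintro ⟨hwℓ, hw⟩
    exact ⟨hw, (hgeo.1 ℓ hℓ).1 hu hwℓ (huw w hw)⟩

theorem IsAssembly.eq_of_mem {G : SimpleGraph V} {q : ℝ} {𝓒 : Set (Set V)}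
    (hgeo : IsGeomLineSet G q 𝓒) (hpasch : DualPasch G 𝓒) {M M' : Set V}
    (hM : IsAssembly G 𝓒 M) (hM' : IsAssembly G 𝓒 M') {x y : V} (hne : x ≠ y)
    (hx : x ∈ M) (hy : y ∈ M) (hx' : x ∈ M') (hy' : y ∈ M') : M = M' := by
  obtain ⟨ℓ, ⟨hℓ, hxℓ, hyℓ⟩, -⟩ := hgeo.2 x y (hM.1.1 hx hy hne)
  have hoff : ∀ z ∈ M, z ∉ ℓ → z ∈ M' := fun z hz hzℓ =>
    hM'.mem_of_adj_of_adj hgeo hpasch hℓ hne hx' hy' hxℓ hyℓ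
      (hM.1.1 hx hz (by rintro rfl; exact hzℓ hxℓ)) (hM.1.1 hy hz (by rintro rfl; exact hzℓ hyℓ))
      hzℓ
  refine (hM.1.2 M' hM'.1.1 fun m hm => ?_).symm
  by_cases hmℓ : m ∈ ℓ
  swap
  · exact hoff m hm hmℓ
  by_cases hmx : m = x
  · exact hmx ▸ hx'
  obtain ⟨z, hz, hzℓ⟩ := hM.exists_notMem_line hgeo hℓ
  have hxz : x ≠ z := by rintro rfl; exact hzℓ hxℓ
  obtain ⟨ℓ₁, ⟨hℓ₁, hxℓ₁, hzℓ₁⟩, -⟩ := hgeo.2 x z (hM.1.1 hx hz hxz)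
  refine hM'.mem_of_adj_of_adj hgeo hpasch hℓ₁ hxz hx' (hoff z hz hzℓ) hxℓ₁ hzℓ₁
    (hM.1.1 hx hm (Ne.symm hmx)) (hM.1.1 hz hm (by rintro rfl; exact hzℓ hmℓ))
    fun hmℓ₁ => hzℓ ?_
  exact hgeo.line_eq hℓ₁ hℓ hmx hmℓ₁ hxℓ₁ hmℓ hxℓ ▸ hzℓ₁

/-- Every clique of a finite graph extends to a maximal clique. -/
theorem exists_isMaxClique_superset [Finite V] {G : SimpleGraph V} {s : Set V}
    (hs : G.IsClique s) : ∃ M, IsMaxClique G M ∧ s ⊆ M := by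
  obtain ⟨M, hsM, hM⟩ := (Set.toFinite {t : Set V | G.IsClique t}).exists_le_maximal hs
  exact ⟨M, ⟨hM.1, fun t ht hMt => (hM.2 ht hMt).antisymm hMt⟩, hsM⟩

/-- Three pairwise adjacent vertices that are not collinear lie in an assembly. -/
theorem exists_isAssembly_of_triangle [Finite V] {G : SimpleGraph V} {q : ℝ} {𝓒 : Set (Set V)}
    (hgeo : IsGeomLineSet G q 𝓒) {ℓ : Set V} (hℓ : ℓ ∈ 𝓒) {x y z : V} (hxℓ : x ∈ ℓ)
    (hyℓ : y ∈ ℓ) (hzℓ : z ∉ ℓ) (hxy : G.Adj x y) (hxz : G.Adj x z) (hyz : G.Adj y z) :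
    ∃ M, IsAssembly G 𝓒 M ∧ x ∈ M ∧ y ∈ M ∧ z ∈ M := by
  have hclique : G.IsClique {x, y, z} := by
    simp only [isClique_insert, isClique_singleton, Set.mem_insert_iff, Set.mem_singleton_iff]
    refine ⟨⟨trivial, ?_⟩, ?_⟩
    · rintro _ rfl -
      exact hyz
    · rintro _ (rfl | rfl) -
      exacts [hxy, hxz]
  obtain ⟨M, hM, hsub⟩ := exists_isMaxClique_superset hclique
  have hx : x ∈ M := hsub (by simp)
  have hy : y ∈ M := hsub (by simp)
  have hz : z ∈ M := hsub (by simp)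
  exact ⟨M, ⟨hM, fun hM𝓒 => hzℓ (hgeo.line_eq hM𝓒 hℓ hxy.ne hx hy hxℓ hyℓ ▸ hz)⟩, hx, hy, hz⟩

theorem cliqueExt_gridGraph_adj {m n A : ℕ} (p q : (Fin m × Fin n) × Fin A) :
    (cliqueExt (gridGraph m n) A).Adj p q ↔ p ≠ q ∧ (p.1.1 = q.1.1 ∨ p.1.2 = q.1.2) := by
  obtain ⟨⟨a, b⟩, c⟩ := p
  obtain ⟨⟨a', b'⟩, c'⟩ := q
  simp only [cliqueExt, gridGraph, fromRel_adj, boxProd_adj, top_adj, Prod.mk.injEq, ne_eq]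
  grind

/-- A graph whose vertices are classified by two labels, with every pair of labels occurring
exactly `A` times and adjacency meaning that some label agrees, is the `A`-clique extension of
a grid. -/
theorem nonempty_iso_cliqueExt_gridGraph {W P Q : Type*} [Finite W] [Finite P] [Finite Q]
    (H : SimpleGraph W) (f : W → P) (g : W → Q) (A : ℕ)
    (hfib : ∀ p q, Nat.card {w // (f w, g w) = (p, q)} = A)
    (hadj : ∀ w w', H.Adj w w' ↔ w ≠ w' ∧ (f w = f w' ∨ g w = g w')) :
    Nonempty (H ≃g cliqueExt (gridGraph (Nat.card P) (Nat.card Q)) A) := by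
  let e : W ≃ (P × Q) × Fin A :=
    (Equiv.sigmaFiberEquiv fun w => (f w, g w)).symm.trans
      ((Equiv.sigmaCongrRight fun pq => Finite.equivFinOfCardEq (hfib pq.1 pq.2)).trans
        (Equiv.sigmaEquivProd (P × Q) (Fin A)))
  have he : ∀ w, (e w).1 = (f w, g w) := fun w => rfl
  let e' : W ≃ (Fin (Nat.card P) × Fin (Nat.card Q)) × Fin A :=
    e.trans (((Finite.equivFin P).prodCongr (Finite.equivFin Q)).prodCongr (Equiv.refl _))
  refine ⟨⟨e', ?_⟩⟩
  intro w w'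
  have h1 : ∀ w, (e' w).1 = (Finite.equivFin P (f w), Finite.equivFin Q (g w)) := fun w => rfl
  rw [cliqueExt_gridGraph_adj, hadj, h1, h1]
  simp

/-- The local structure at `x` when every line meets every assembly in `0` or `A + 1` points. -/
theorem nonempty_local_iso [Finite V] {G : SimpleGraph V} {q : ℝ} {𝓒 : Set (Set V)}
    (hgeo : IsGeomLineSet G q 𝓒) (hpasch : DualPasch G 𝓒) {A : ℕ}
    (hinter : ∀ ℓ ∈ 𝓒, ∀ M, IsAssembly G 𝓒 M → (ℓ ∩ M).Nonempty → (ℓ ∩ M).ncard = A + 1)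
    (x : V) (hasm : ∀ y, G.Adj x y → ∃ M, IsAssembly G 𝓒 M ∧ x ∈ M ∧ y ∈ M) :
    Nonempty (G.induce (G.neighborSet x) ≃g
      cliqueExt (gridGraph (Nat.card {M // IsAssembly G 𝓒 M ∧ x ∈ M})
        (Nat.card {ℓ // ℓ ∈ 𝓒 ∧ x ∈ ℓ})) A) := by
  choose asm hasmM hasmx hasmy using hasm
  choose line hline hlineu using hgeo.2 x
  refine nonempty_iso_cliqueExt_gridGraph (W := G.neighborSet x) _
    (fun y => ⟨asm y y.2, hasmM y y.2, hasmx y y.2⟩)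
    (fun y => ⟨line y y.2, (hline y y.2).1, (hline y y.2).2.1⟩) A ?_ ?_
  · rintro ⟨M, hM, hxM⟩ ⟨ℓ, hℓ, hxℓ⟩
    have hcard := hinter ℓ hℓ M hM ⟨x, hxℓ, hxM⟩
    have hdiff : ((ℓ ∩ M) \ {x}).ncard = A := by
      rw [Set.ncard_sdiff_singleton_of_mem (Set.mem_inter hxℓ hxM), hcard, Nat.add_sub_cancel]
    rw [← hdiff, ← Nat.card_coe_set_eq]
    refine Nat.card_congr
      { toFun := fun w => ⟨w.1.1, ?_⟩
        invFun := fun v => ⟨⟨v.1, ?_⟩, ?_⟩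
        left_inv := fun _ => rfl
        right_inv := fun _ => rfl }
    · obtain ⟨⟨y, hy⟩, hw⟩ := w
      simp only [Prod.mk.injEq, Subtype.mk.injEq] at hw
      obtain ⟨rfl, rfl⟩ := hw
      exact ⟨⟨(hline y hy).2.2, hasmy y hy⟩, (G.ne_of_adj hy).symm⟩
    · obtain ⟨v, ⟨hvℓ, hvM⟩, hvx⟩ := v
      exact hM.1.1 hxM hvM (Ne.symm hvx)
    · obtain ⟨v, ⟨hvℓ, hvM⟩, hvx⟩ := v
      have hadj : G.Adj x v := hM.1.1 hxM hvM (Ne.symm hvx)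
      simp only [Prod.mk.injEq, Subtype.mk.injEq]
      exact ⟨(hasmM v hadj).eq_of_mem hgeo hpasch hM hadj.ne (hasmx v hadj) (hasmy v hadj) hxM hvM,
        (hlineu v hadj ℓ ⟨hℓ, hxℓ, hvℓ⟩).symm⟩
  · rintro ⟨y, hy⟩ ⟨z, hz⟩
    simp only [comap_adj, Function.Embedding.subtype_apply, ne_eq, Subtype.mk.injEq]
    constructor
    · intro hyz
      refine ⟨hyz.ne, ?_⟩
      by_cases hzℓ : z ∈ line y hy
      · exact Or.inr (hlineu z hz (line y hy) ⟨(hline y hy).1, (hline y hy).2.1, hzℓ⟩)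
      · left
        have hzM : z ∈ asm y hy := (hasmM y hy).mem_of_adj_of_adj hgeo hpasch (hline y hy).1
          (G.ne_of_adj hy) (hasmx y hy) (hasmy y hy) (hline y hy).2.1 (hline y hy).2.2 hz hyz hzℓ
        exact (hasmM y hy).eq_of_mem hgeo hpasch (hasmM z hz) (G.ne_of_adj hz) (hasmx y hy) hzM
          (hasmx z hz) (hasmy z hz)
    · rintro ⟨hne, heq | heq⟩
      · exact (hasmM z hz).1.1 (heq ▸ hasmy y hy) (hasmy z hz) hne
      · exact (hgeo.1 _ (hline z hz).1).1 (heq ▸ (hline y hy).2.2) (hline z hz).2.2 hne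

section Counting

open Finset Classical

/-- Two distinct vertices lie on one common line if they are adjacent and on none otherwise. -/
theorem IsGeomLineSet.card_lines_through [Fintype V] {G : SimpleGraph V} {q : ℝ}
    {𝓒 : Set (Set V)} (hgeo : IsGeomLineSet G q 𝓒) {y z : V} (hne : y ≠ z) :
    #{ℓ : Set V | ℓ ∈ 𝓒 ∧ y ∈ ℓ ∧ z ∈ ℓ} = if G.Adj y z then 1 else 0 := by
  split_ifs with hadj
  · obtain ⟨ℓ, hℓ, huniq⟩ := hgeo.2 y z hadj
    rw [card_eq_one]
    refine ⟨ℓ, ?_⟩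
    ext ℓ'
    simp only [mem_filter, mem_univ, true_and, mem_singleton]
    exact ⟨huniq ℓ', fun heq => heq ▸ hℓ⟩
  · rw [card_eq_zero, filter_eq_empty_iff]
    rintro ℓ - ⟨hℓ, hy, hz⟩
    exact hadj ((hgeo.1 ℓ hℓ).1 hy hz hne)

/-- Through each vertex `x` there are `k / β` lines. -/
theorem IsGeomLineSet.card_lines_mul [Fintype V] {G : SimpleGraph V} {β : ℝ}
    {𝓒 : Set (Set V)} (hgeo : IsGeomLineSet G (β + 1) 𝓒) (x : V) :
    (#{ℓ : Set V | ℓ ∈ 𝓒 ∧ x ∈ ℓ} : ℝ) * β = #{z | G.Adj x z} := by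
  have hcount := sum_card_bipartiteAbove_eq_sum_card_bipartiteBelow
    (s := ({ℓ : Set V | ℓ ∈ 𝓒 ∧ x ∈ ℓ} : Finset (Set V)))
    (t := ({z | z ≠ x} : Finset V)) (fun ℓ z => z ∈ ℓ)
  have hleft : ∀ ℓ ∈ ({ℓ : Set V | ℓ ∈ 𝓒 ∧ x ∈ ℓ} : Finset (Set V)),
      (#(bipartiteAbove (fun ℓ z => z ∈ ℓ) ({z | z ≠ x} : Finset V) ℓ) : ℝ) = β := by
    intro ℓ hℓ
    simp only [mem_filter, mem_univ, true_and] at hℓ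
    have heq : ((bipartiteAbove (fun (ℓ : Set V) z => z ∈ ℓ) ({z | z ≠ x} : Finset V) ℓ :
        Finset V) : Set V) = ℓ \ {x} := by
      ext z
      simp [bipartiteAbove, and_comm]
    rw [← Set.ncard_coe_finset, heq]
    have hone := Set.ncard_sdiff_singleton_add_one hℓ.2
    have hcard := (hgeo.1 ℓ hℓ.1).2
    rw [← hone] at hcard
    push_cast at hcard
    linarith
  have hright : ∀ z ∈ ({z | z ≠ x} : Finset V),
      #(bipartiteBelow (fun ℓ z => z ∈ ℓ) ({ℓ : Set V | ℓ ∈ 𝓒 ∧ x ∈ ℓ} : Finset (Set V)) z) =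
        if G.Adj x z then 1 else 0 := by
    intro z hz
    rw [← hgeo.card_lines_through (mem_filter.1 hz).2.symm, bipartiteBelow, filter_filter]
    simp only [and_assoc]
  rw [sum_congr rfl hright, ← card_filter, filter_filter] at hcount
  have hcount' := congrArg (Nat.cast : ℕ → ℝ) hcount
  rw [Nat.cast_sum, sum_congr rfl hleft, sum_const, nsmul_eq_mul] at hcount'
  rw [hcount']
  congr 2
  ext z
  simp only [mem_filter, mem_univ, true_and, and_iff_right_iff_imp]
  exact fun hadj => hadj.ne.symm

/-- If each vertex is on `r` lines, eigenvectors for the eigenvalue `-r` sum to zero on lines. -/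
theorem IsGeomLineSet.sum_line_eq_zero [Fintype V] {G : SimpleGraph V} {q r : ℝ}
    {𝓒 : Set (Set V)} (hgeo : IsGeomLineSet G q 𝓒)
    (hr : ∀ x, (#{ℓ : Set V | ℓ ∈ 𝓒 ∧ x ∈ ℓ} : ℝ) = r) (e : V → ℝ)
    (he : ∀ y, ∑ z with G.Adj y z, e z = -r * e y) {ℓ : Set V} (hℓ : ℓ ∈ 𝓒) :
    ∑ y with y ∈ ℓ, e y = 0 := by
  have hpair : ∀ y z, (#{ℓ : Set V | ℓ ∈ 𝓒 ∧ y ∈ ℓ ∧ z ∈ ℓ} : ℝ) =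
      (if y = z then r else 0) + if G.Adj y z then 1 else 0 := by
    intro y z
    by_cases hyz : y = z
    · subst hyz
      simp [← hr y]
    · rw [hgeo.card_lines_through hyz]
      simp [hyz]
  have hsq : ∑ ℓ : Set V with ℓ ∈ 𝓒, (∑ y with y ∈ ℓ, e y) ^ 2 = 0 := by
    calc ∑ ℓ : Set V with ℓ ∈ 𝓒, (∑ y with y ∈ ℓ, e y) ^ 2
        = ∑ ℓ : Set V, ∑ y, ∑ z, if ℓ ∈ 𝓒 ∧ y ∈ ℓ ∧ z ∈ ℓ then e y * e z else 0 := by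
          rw [sum_filter]
          refine sum_congr rfl fun ℓ _ => ?_
          by_cases hℓ : ℓ ∈ 𝓒
          · simp only [hℓ, if_true, true_and, sq, sum_filter, sum_mul_sum]
            refine sum_congr rfl fun y _ => sum_congr rfl fun z _ => ?_
            by_cases hy : y ∈ ℓ <;> by_cases hz : z ∈ ℓ <;> simp [hy, hz]
          · simp [hℓ]
      _ = ∑ y, ∑ z, (#{ℓ : Set V | ℓ ∈ 𝓒 ∧ y ∈ ℓ ∧ z ∈ ℓ} : ℝ) * (e y * e z) := by
          rw [sum_comm]
          refine sum_congr rfl fun y _ => ?_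
          rw [sum_comm]
          refine sum_congr rfl fun z _ => ?_
          rw [← sum_filter, sum_const, nsmul_eq_mul]
      _ = ∑ y, e y * (r * e y + ∑ z with G.Adj y z, e z) := by
          refine sum_congr rfl fun y _ => ?_
          simp only [hpair, add_mul, sum_add_distrib, ite_mul, zero_mul, one_mul, sum_ite_eq,
            mem_univ, if_true, sum_filter, mul_add, mul_sum, mul_ite, mul_zero]
          ring
      _ = 0 := sum_eq_zero fun y _ => by rw [he]; ring
  have hzero := (sum_eq_zero_iff_of_nonneg fun ℓ _ => sq_nonneg _).1 hsq ℓ (by simpa using hℓ)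
  exact pow_eq_zero_iff two_ne_zero |>.1 hzero

/-- Sums over the neighbours of `y` of a function of the distance to `x`. -/
theorem IsDRG.sum_adj_dist [Fintype V] {G : SimpleGraph V} {D : ℕ} {cc aa bb : ℕ → ℕ}
    (hdrg : IsDRG G D cc aa bb) (f : ℕ → ℝ) {x y : V} {i : ℕ} (hi : G.dist x y = i + 1) :
    ∑ z with G.Adj y z, f (G.dist x z) =
      cc (i + 1) * f i + aa (i + 1) * f (i + 1) + bb (i + 1) * f (i + 2) := by
  obtain ⟨hconn, hle, -, harr⟩ := hdrg
  obtain ⟨hc, ha, hb⟩ := harr (i + 1) (hi ▸ hle x y) x y hi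
  have hcard : ∀ j, (#{z | G.Adj y z ∧ G.dist x z = j} : ℝ) * f j =
      ∑ z with G.Adj y z, if G.dist x z = j then f (G.dist x z) else 0 := by
    intro j
    rw [← sum_filter, filter_filter, ← nsmul_eq_mul, ← sum_const]
    exact sum_congr rfl fun z hz => by rw [(mem_filter.1 hz).2.2]
  have hncard : ∀ j, {z | G.Adj y z ∧ G.dist x z = j}.ncard = #{z | G.Adj y z ∧ G.dist x z = j} :=
    fun j => by rw [← Set.ncard_coe_finset]; simp
  rw [hncard] at hc ha hb
  rw [← hc, ← ha, ← hb, Nat.add_sub_cancel, hcard, hcard, hcard, ← sum_add_distrib,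
    ← sum_add_distrib]
  refine sum_congr rfl fun z hz => ?_
  have hyz : G.Adj y z := (mem_filter.1 hz).2
  have h1 : G.dist y z = 1 := dist_eq_one_iff_adj.2 hyz
  have h2 := hconn.dist_triangle (u := x) (v := y) (w := z)
  have h3 := hconn.dist_triangle (u := x) (v := z) (w := y)
  rw [G.dist_comm (u := z), h1] at h3
  obtain h | h | h : G.dist x z = i ∨ G.dist x z = i + 1 ∨ G.dist x z = i + 2 := by omega
  all_goals simp [h, add_assoc]

theorem IsDRG.card_adj [Fintype V] {G : SimpleGraph V} {D : ℕ} {cc aa bb : ℕ → ℕ}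
    (hdrg : IsDRG G D cc aa bb) (x : V) : #{z | G.Adj x z} = bb 0 := by
  rw [← (hdrg.2.2.2 0 (Nat.zero_le D) x x dist_self).2.2, ← Set.ncard_coe_finset]
  simp

/-- Two vertices at distance `i + 1` exist for `i < D`, joined through one at distance `i`. -/
theorem IsDRG.exists_dist_succ [Fintype V] {G : SimpleGraph V} {D : ℕ} {cc aa bb : ℕ → ℕ}
    (hdrg : IsDRG G D cc aa bb) {i : ℕ} (hi : i < D) :
    ∃ x y z, G.dist x y = i ∧ G.Adj y z ∧ G.dist x z = i + 1 := by
  obtain ⟨hconn, -, ⟨x, w, hxw⟩, -⟩ := hdrg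
  obtain ⟨p, hp⟩ := hconn.exists_walk_length_eq_dist x w
  have hdist : ∀ j ≤ D, G.dist x (p.getVert j) = j := by
    intro j hj
    have h1 : G.dist x (p.getVert j) ≤ j :=
      (dist_le (p.take j)).trans (by simp)
    have h2 : G.dist (p.getVert j) w ≤ D - j :=
      (dist_le (p.drop j)).trans (by simp [hp, hxw])
    have h3 := hconn.dist_triangle (u := x) (v := p.getVert j) (w := w)
    omega
  exact ⟨x, p.getVert i, p.getVert (i + 1), hdist i hi.le, p.adj_getVert_succ (by omega),
    hdist (i + 1) hi⟩

end Counting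

@[simp]
theorem gauss_zero (b : ℕ) : gauss b 0 = 0 := by simp [gauss]

@[simp]
theorem gauss_one (b : ℕ) : gauss b 1 = 1 := by simp [gauss]

/-- The standard sequence of the eigenvalue `-[D]`. -/
noncomputable def stdSeq (b : ℕ) (α β : ℝ) : ℕ → ℝ
  | 0 => 1
  | i + 1 => -(stdSeq b α β i * (1 + α * gauss b i)) / (β - α * gauss b i)

section Classical

open Finset Classical

variable [Fintype V] {G : SimpleGraph V} {D b : ℕ} {α β : ℝ} {cc aa bb : ℕ → ℕ}

theorem HasClassicalParams.bb_ne_zero (h : HasClassicalParams G D b α β cc aa bb) {i : ℕ}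
    (hi : i < D) : (bb i : ℝ) ≠ 0 := by
  obtain ⟨x, y, z, hxy, hyz, hxz⟩ := h.1.exists_dist_succ hi
  rw [Nat.cast_ne_zero, ← (h.1.2.2.2 i hi.le x y hxy).2.2]
  exact Set.ncard_ne_zero_of_mem (a := z) ⟨hyz, hxz⟩

theorem HasClassicalParams.sub_ne_zero (h : HasClassicalParams G D b α β cc aa bb) {i : ℕ}
    (hi : i < D) : β - α * gauss b i ≠ 0 := by
  have hbb := h.bb_ne_zero hi
  rw [h.2.1 i (by omega)] at hbb
  exact right_ne_zero_of_mul hbb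

theorem HasClassicalParams.bb_zero (h : HasClassicalParams G D b α β cc aa bb) :
    (bb 0 : ℝ) = gauss b D * β := by
  simpa using h.2.1 0 (Nat.zero_le _)

theorem HasClassicalParams.stdSeq_succ_mul (h : HasClassicalParams G D b α β cc aa bb) {i : ℕ}
    (hi : i < D) : (β - α * gauss b i) * stdSeq b α β (i + 1) =
      -(stdSeq b α β i * (1 + α * gauss b i)) := by
  rw [stdSeq, mul_div_cancel₀ _ (h.sub_ne_zero hi)]

/-- The standard sequence gives an eigenvector for `-[D]` around each vertex `x`. -/
theorem HasClassicalParams.sum_adj_stdSeq (h : HasClassicalParams G D b α β cc aa bb)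
    (hD : 0 < D) (x y : V) :
    ∑ z with G.Adj y z, stdSeq b α β (G.dist x z) =
      -gauss b D * stdSeq b α β (G.dist x y) := by
  have hdrg := h.1
  rcases hi : G.dist x y with _ | i
  · obtain rfl : x = y := hdrg.1.dist_eq_zero_iff.1 hi
    have hsum : ∑ z with G.Adj x z, stdSeq b α β (G.dist x z) =
        ∑ z with G.Adj x z, stdSeq b α β 1 :=
      sum_congr rfl fun z hz => by rw [dist_eq_one_iff_adj.2 (mem_filter.1 hz).2]
    have hstd := h.stdSeq_succ_mul hD
    rw [gauss_zero, mul_zero, sub_zero, add_zero, mul_one, zero_add] at hstd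
    rw [hsum, sum_const, nsmul_eq_mul, hdrg.card_adj, h.bb_zero, mul_assoc, hstd]
    ring
  · have hiD : i + 1 ≤ D := hi ▸ hdrg.2.1 x y
    have hk := hdrg.sum_adj_dist (fun _ => 1) hi
    rw [sum_const, nsmul_eq_mul, hdrg.card_adj, h.bb_zero] at hk
    have hc := h.2.2 (i + 1) (by omega) hiD
    rw [Nat.add_sub_cancel] at hc
    have hstd := h.stdSeq_succ_mul (i := i) (by omega)
    rw [hdrg.sum_adj_dist _ hi]
    have hbs : (bb (i + 1) : ℝ) * stdSeq b α β (i + 2) = -((gauss b D - gauss b (i + 1)) *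
        (1 + α * gauss b (i + 1)) * stdSeq b α β (i + 1)) ∧
        (bb (i + 1) : ℝ) = (gauss b D - gauss b (i + 1)) * (β - α * gauss b (i + 1)) := by
      rcases hiD.lt_or_eq with hlt | heq
      · have hb := h.2.1 (i + 1) (by omega)
        refine ⟨?_, hb⟩
        rw [hb, mul_assoc, h.stdSeq_succ_mul hlt]
        ring
      · have hb : bb (i + 1) = 0 := by
          rw [← (hdrg.2.2.2 (i + 1) hiD x y hi).2.2, Set.ncard_eq_zero]
          ext z
          have := hdrg.2.1 x z
          simp only [Set.mem_ofPred_eq, Set.mem_empty_iff_false, iff_false, not_and]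
          omega
        rw [hb, heq]
        simp
    obtain ⟨hbs, hb⟩ := hbs
    have ha : (aa (i + 1) : ℝ) = gauss b D * β - cc (i + 1) - bb (i + 1) := by linarith
    rw [hbs, ha, hb, hc]
    linear_combination gauss b (i + 1) * hstd

theorem HasClassicalParams.card_lines (h : HasClassicalParams G D b α β cc aa bb) (hD : 0 < D)
    {𝓒 : Set (Set V)} (hgeo : IsGeomLineSet G (β + 1) 𝓒) (x : V) :
    (#{ℓ : Set V | ℓ ∈ 𝓒 ∧ x ∈ ℓ} : ℝ) = gauss b D := by
  have hβ : β ≠ 0 := by simpa using h.sub_ne_zero hD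
  have hmul := hgeo.card_lines_mul x
  rw [h.1.card_adj, h.bb_zero] at hmul
  exact mul_right_cancel₀ hβ hmul

/-- A vertex off a line with a neighbour on it has exactly `α + 1` neighbours on it. -/
theorem HasClassicalParams.ncard_adj_line (h : HasClassicalParams G D b α β cc aa bb)
    (hD : 1 < D) {𝓒 : Set (Set V)} (hgeo : IsGeomLineSet G (β + 1) 𝓒) {ℓ : Set V} (hℓ : ℓ ∈ 𝓒)
    {x : V} (hx : x ∉ ℓ) (hadj : ∃ v ∈ ℓ, G.Adj x v) :
    ({v ∈ ℓ | G.Adj x v}.ncard : ℝ) = α + 1 := by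
  obtain ⟨v, hvℓ, hxv⟩ := hadj
  have hconn := h.1.1
  have hsum := hgeo.sum_line_eq_zero (h.card_lines (by omega) hgeo)
    (fun z => stdSeq b α β (G.dist x z)) (h.sum_adj_stdSeq (by omega) x) hℓ
  have hdist : ∀ y ∈ ℓ, ¬ G.Adj x y → G.dist x y = 2 := by
    intro y hy hxy
    have hxy' : x ≠ y := by rintro rfl; exact hx hy
    have h1 := hconn.one_lt_dist_of_ne_of_not_adj hxy' hxy
    have hvy : G.Adj v y := (hgeo.1 ℓ hℓ).1 hvℓ hy (by rintro rfl; exact hxy hxv)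
    have h2 := hconn.dist_triangle (u := x) (v := v) (w := y)
    rw [dist_eq_one_iff_adj.2 hxv, dist_eq_one_iff_adj.2 hvy] at h2
    omega
  have hsplit : ∑ y with y ∈ ℓ, stdSeq b α β (G.dist x y) =
      (#{y | y ∈ ℓ ∧ G.Adj x y} : ℝ) * stdSeq b α β 1 +
        (#{y | y ∈ ℓ ∧ ¬ G.Adj x y} : ℝ) * stdSeq b α β 2 := by
    rw [← sum_filter_add_sum_filter_not _ (fun y => G.Adj x y), filter_filter, filter_filter,
      ← nsmul_eq_mul, ← nsmul_eq_mul, ← sum_const, ← sum_const]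
    congr 1
    · exact sum_congr rfl fun y hy => by rw [dist_eq_one_iff_adj.2 (mem_filter.1 hy).2.2]
    · exact sum_congr rfl fun y hy => by
        rw [hdist y (mem_filter.1 hy).2.1 (mem_filter.1 hy).2.2]
  have htotal : (#{y | y ∈ ℓ ∧ G.Adj x y} : ℝ) + #{y | y ∈ ℓ ∧ ¬ G.Adj x y} = β + 1 := by
    rw [← (hgeo.1 ℓ hℓ).2, ← Nat.cast_add, ← filter_filter, ← filter_filter,
      card_filter_add_card_filter_not, ← Set.ncard_coe_finset]
    simp
  have hncard : {v ∈ ℓ | G.Adj x v}.ncard = #{y | y ∈ ℓ ∧ G.Adj x y} := by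
    rw [← Set.ncard_coe_finset]
    simp
  rw [hncard]
  rw [hsplit] at hsum
  have hone := h.stdSeq_succ_mul (i := 0) (by omega)
  have htwo := h.stdSeq_succ_mul hD
  simp only [gauss_zero, gauss_one, mul_zero, sub_zero, add_zero, mul_one, zero_add,
    one_add_one_eq_two] at hone htwo
  have hstd : stdSeq b α β 1 ≠ 0 := by
    intro hzero
    rw [hzero, mul_zero, stdSeq] at hone
    norm_num at hone
  have hβ : β + 1 ≠ 0 := by
    rw [← (hgeo.1 ℓ hℓ).2, Nat.cast_ne_zero]
    exact Set.ncard_ne_zero_of_mem hvℓ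
  set p : ℝ := (#{y | y ∈ ℓ ∧ G.Adj x y} : ℝ)
  set p' : ℝ := (#{y | y ∈ ℓ ∧ ¬ G.Adj x y} : ℝ)
  have hprod : (β + 1) * stdSeq b α β 1 * (p - (α + 1)) = 0 := by
    linear_combination (β - α) * hsum - p' * htwo + (1 + α) * stdSeq b α β 1 * htotal
  have := (mul_eq_zero.1 hprod).resolve_left (mul_ne_zero hβ hstd)
  linarith

end Classical

/-- for a geometric distance-regular graph with classical parameters
`(D, b, α, β)`, `b ≥ 2`, `1 ≤ α ≤ b - 1`, `D ≥ 3`, line set `𝓒` and `r = [D]`, satisfying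
the dual Pasch axiom: (1) a line meeting an assembly meets it in exactly `α + 1` vertices;
(2) a vertex outside an assembly `M` with a neighbour in `M` has exactly `α + 1` neighbours
in `M` and lies on exactly one line meeting `M`; consequently every local graph is the
`α`-clique extension of the `(β/α) × r` grid. -/
theorem statement_16 {V : Type*} [Fintype V] (G : SimpleGraph V) (D b : ℕ) (α β : ℝ)
    (cc aa bb : ℕ → ℕ) (hb : 2 ≤ b) (hD : 3 ≤ D)
    (hα : 1 ≤ α ∧ α ≤ (b : ℝ) - 1)
    (h : HasClassicalParams G D b α β cc aa bb)
    (𝓒 : Set (Set V)) (hgeo : IsGeomLineSet G (β + 1) 𝓒)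
    (hpasch : DualPasch G 𝓒) :
    (∀ ℓ ∈ 𝓒, ∀ M : Set V, IsAssembly G 𝓒 M → (ℓ ∩ M).Nonempty →
      ((ℓ ∩ M).ncard : ℝ) = α + 1) ∧
    (∀ M : Set V, IsAssembly G 𝓒 M → ∀ u : V, u ∉ M → (∃ v ∈ M, G.Adj u v) →
      ({v ∈ M | G.Adj u v}.ncard : ℝ) = α + 1 ∧
      (∃! ℓ : Set V, ℓ ∈ 𝓒 ∧ u ∈ ℓ ∧ (ℓ ∩ M).Nonempty)) ∧
    (∃ A m n : ℕ, (A : ℝ) = α ∧ (m : ℝ) = β / α ∧ (n : ℝ) = gauss b D ∧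
      ∀ x : V, Nonempty ((G.induce (G.neighborSet x)) ≃g cliqueExt (gridGraph m n) A)) := by
  classical
  have hline := fun ℓ hℓ x hx => h.ncard_adj_line (by omega) hgeo (ℓ := ℓ) hℓ (x := x) hx
  have hinter : ∀ ℓ ∈ 𝓒, ∀ M : Set V, IsAssembly G 𝓒 M → (ℓ ∩ M).Nonempty →
      ((ℓ ∩ M).ncard : ℝ) = α + 1 := by
    intro ℓ hℓ M hM hne
    obtain ⟨z, hz, hadj, heq⟩ := hM.exists_line_inter_eq hgeo hpasch hℓ hne
    rw [heq]
    exact hline ℓ hℓ z hz hadj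
  refine ⟨hinter, ?_, ?_⟩
  · rintro M hM u hu ⟨v, hv, huv⟩
    obtain ⟨ℓ, ⟨hℓ, huℓ, hvℓ⟩, -⟩ := hgeo.2 u v huv
    have heq := hM.adj_eq_line_inter hgeo hpasch hℓ hu huℓ ⟨v, hvℓ, hv⟩
    refine ⟨?_, ℓ, ⟨hℓ, huℓ, v, hvℓ, hv⟩, ?_⟩
    · rw [heq]
      exact hinter ℓ hℓ M hM ⟨v, hvℓ, hv⟩
    · rintro ℓ' ⟨hℓ', huℓ', w, hwℓ', hw⟩
      have huw : u ≠ w := by rintro rfl; exact hu hw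
      have hwℓ : w ∈ ℓ ∩ M := heq ▸ ⟨hw, (hgeo.1 ℓ' hℓ').1 huℓ' hwℓ' huw⟩
      exact hgeo.line_eq hℓ' hℓ huw huℓ' hwℓ' huℓ hwℓ.1
  · obtain ⟨A, hA⟩ : ∃ A : ℕ, (A : ℝ) = α := by
      obtain ⟨x, y, z, hxy, hyz, hxz⟩ := h.1.exists_dist_succ (i := 1) (by omega)
      rw [dist_eq_one_iff_adj] at hxy
      obtain ⟨ℓ, ⟨hℓ, hyℓ, hzℓ⟩, -⟩ := hgeo.2 y z hyz
      have hxz' : x ≠ z := by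
        rintro rfl
        simp at hxz
      have hxℓ : x ∉ ℓ := fun hxℓ => by
        have := dist_eq_one_iff_adj.2 ((hgeo.1 ℓ hℓ).1 hxℓ hzℓ hxz')
        omega
      have hcard := hline ℓ hℓ x hxℓ ⟨y, hyℓ, hxy⟩
      have hpos : 0 < {v ∈ ℓ | G.Adj x v}.ncard := (Set.ncard_pos (Set.toFinite _)).2 ⟨y, hyℓ, hxy⟩
      refine ⟨{v ∈ ℓ | G.Adj x v}.ncard - 1, ?_⟩
      rw [Nat.cast_pred hpos, hcard]
      ring
    have hα0 : α ≠ 0 := by linarith [hα.1]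
    have hr : 1 < gauss b D := by
      have hsub : Finset.range 2 ⊆ Finset.range D := Finset.range_mono (by omega)
      have hle := Finset.sum_le_sum_of_subset_of_nonneg hsub
        (f := fun i => (b : ℝ) ^ i) fun i _ _ => by positivity
      have hb' : (2 : ℝ) ≤ b := by exact_mod_cast hb
      simp only [Finset.sum_range_succ, Finset.range_zero, Finset.sum_empty, pow_zero,
        pow_one, zero_add] at hle
      rw [gauss]
      linarith
    have hlines : ∀ x : V, (Nat.card {ℓ // ℓ ∈ 𝓒 ∧ x ∈ ℓ} : ℝ) = gauss b D := by
      intro x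
      rw [← h.card_lines (by omega) hgeo x, Nat.card_eq_fintype_card, Fintype.card_subtype]
    have hasm : ∀ x y, G.Adj x y → ∃ M, IsAssembly G 𝓒 M ∧ x ∈ M ∧ y ∈ M := by
      intro x y hxy
      obtain ⟨ℓ, ⟨hℓ, hxℓ, hyℓ⟩, -⟩ := hgeo.2 x y hxy
      have hcard : 1 < Nat.card {ℓ // ℓ ∈ 𝓒 ∧ x ∈ ℓ} := by
        exact_mod_cast (hlines x).symm ▸ hr
      have : Nontrivial {ℓ // ℓ ∈ 𝓒 ∧ x ∈ ℓ} := Finite.one_lt_card_iff_nontrivial.1 hcard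
      obtain ⟨⟨ℓ', hℓ', hxℓ'⟩, hne⟩ := exists_ne (⟨ℓ, hℓ, hxℓ⟩ : {ℓ // ℓ ∈ 𝓒 ∧ x ∈ ℓ})
      rw [ne_eq, Subtype.mk.injEq] at hne
      have hyℓ' : y ∉ ℓ' := fun hyℓ' =>
        hne (hgeo.line_eq hℓ' hℓ hxy.ne hxℓ' hyℓ' hxℓ hyℓ)
      have hadj := hline ℓ' hℓ' y hyℓ' ⟨x, hxℓ', hxy.symm⟩
      have htwo : 1 < {v ∈ ℓ' | G.Adj y v}.ncard := by
        have : (1 : ℝ) < {v ∈ ℓ' | G.Adj y v}.ncard := by linarith [hα.1]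
        exact_mod_cast this
      obtain ⟨z, ⟨hzℓ', hyz⟩, hzx⟩ := Set.exists_ne_of_one_lt_ncard htwo x
      obtain ⟨M, hM, hx, hy, -⟩ := exists_isAssembly_of_triangle hgeo hℓ hxℓ hyℓ
        (fun hzℓ => hne (hgeo.line_eq hℓ' hℓ hzx hzℓ' hxℓ' hzℓ hxℓ)) hxy
        ((hgeo.1 ℓ' hℓ').1 hxℓ' hzℓ' hzx.symm) hyz
      exact ⟨M, hM, hx, hy⟩
    have hiso := fun x => nonempty_local_iso hgeo hpasch (A := A)
      (fun ℓ hℓ M hM hne => by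
        have := hinter ℓ hℓ M hM hne
        rw [← hA] at this
        exact_mod_cast this) x (hasm x)
    have hassemblies : ∀ x : V, (Nat.card {M // IsAssembly G 𝓒 M ∧ x ∈ M} : ℝ) = β / α := by
      intro x
      obtain ⟨e⟩ := hiso x
      have hcard := Nat.card_congr e.toEquiv
      have hnbr : Nat.card (G.neighborSet x) = bb 0 := by
        rw [← h.1.card_adj x, Nat.card_coe_set_eq, ← Set.ncard_coe_finset]
        congr 1
        ext z
        simp
      rw [hnbr] at hcard
      simp only [Nat.card_prod, Nat.card_fin] at hcard
      have hcard' := congrArg (Nat.cast : ℕ → ℝ) hcard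
      push_cast at hcard'
      rw [h.bb_zero, hlines, hA] at hcard'
      rw [eq_div_iff hα0]
      refine mul_left_cancel₀ (by linarith : gauss b D ≠ 0) ?_
      linear_combination -hcard'
    obtain ⟨x₀⟩ := h.1.1.nonempty
    refine ⟨A, Nat.card {M // IsAssembly G 𝓒 M ∧ x₀ ∈ M}, Nat.card {ℓ // ℓ ∈ 𝓒 ∧ x₀ ∈ ℓ}, hA,
      hassemblies x₀, hlines x₀, fun x => ?_⟩
    have hm : Nat.card {M // IsAssembly G 𝓒 M ∧ x₀ ∈ M} =
        Nat.card {M // IsAssembly G 𝓒 M ∧ x ∈ M} := by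
      exact_mod_cast (hassemblies x₀).trans (hassemblies x).symm
    have hn : Nat.card {ℓ // ℓ ∈ 𝓒 ∧ x₀ ∈ ℓ} = Nat.card {ℓ // ℓ ∈ 𝓒 ∧ x ∈ ℓ} := by
      exact_mod_cast (hlines x₀).trans (hlines x).symm
    rw [hm, hn]
    exact hiso x
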